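/- The only idempotent elements of the group ring ℤ[G] of a finite group G are 0 and 1. -/

import Mathlib

/-- The coefficient at 1 of an idempotent is nonnegative, and vanishes only for e = 0. -/
theorem idem_coeff_one (G : Type*) [Group G] [Finite G] (e : MonoidAlgebra ℤ G)
    (he : e * e = e) : 0 ≤ e.coeff 1 ∧ (e.coeff 1 = 0 → e = 0) := by
  classical
  have := Fintype.ofFinite G
  have hfin : Module.Finite ℤ (MonoidAlgebra ℤ G) := Module.Finite.of_basis (MonoidAlgebra.basis G ℤ)
  have hfree : Module.Free ℤ (MonoidAlgebra ℤ G) := Module.Free.of_basis (MonoidAlgebra.basis G ℤ)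
  have hL : IsIdempotentElem (LinearMap.mulLeft ℤ e) := by
    refine LinearMap.ext fun x => ?_
    change e * (e * x) = e * x
    rw [← mul_assoc, he]
  have htr : LinearMap.trace ℤ _ (LinearMap.mulLeft ℤ e) = Fintype.card G * e.coeff 1 := by
    rw [LinearMap.trace_eq_matrix_trace ℤ (MonoidAlgebra.basis G ℤ), Matrix.trace]
    have h : ∀ g : G, (LinearMap.toMatrix (MonoidAlgebra.basis G ℤ) (MonoidAlgebra.basis G ℤ)
        (LinearMap.mulLeft ℤ e)).diag g = e.coeff 1 := by
      intro g
      rw [Matrix.diag_apply, LinearMap.toMatrix_apply, LinearMap.mulLeft_apply,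
        MonoidAlgebra.basis_apply]
      change (e * MonoidAlgebra.single g 1).coeff g = _
      rw [MonoidAlgebra.coeff_mul_single_apply]
      simp
    rw [Finset.sum_congr rfl fun g _ => h g]
    simp
  have hpos : (0 : ℤ) < Fintype.card G := by exact_mod_cast Fintype.card_pos
  constructor
  · have h := (LinearMap.IsIdempotentElem.isProj_range _ hL).trace
    rw [htr] at h
    refine nonneg_of_mul_nonneg_right ?_ hpos
    rw [h]
    positivity
  · intro h0
    rw [h0, mul_zero] at htr
    have h := LinearMap.IsIdempotentElem.eq_zero_of_trace_eq_zero hL htr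
    simpa using congrArg (fun f => f 1) h

/-- The only idempotents of the integral group ring of a finite group are 0 and 1. -/
theorem stmt_10 (G : Type*) [Group G] [Finite G] (e : MonoidAlgebra ℤ G)
    (he : e * e = e) : e = 0 ∨ e = 1 := by
  have he' : (1 - e) * (1 - e) = 1 - e := (IsIdempotentElem.one_sub (show IsIdempotentElem e from he))
  obtain ⟨h1, h2⟩ := idem_coeff_one G e he
  obtain ⟨h3, h4⟩ := idem_coeff_one G (1 - e) he'
  have h5 : (1 - e).coeff 1 = 1 - e.coeff 1 := by
    simp [MonoidAlgebra.one_def]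
  rw [h5] at h3 h4
  by_cases h : e.coeff 1 = 0
  · exact Or.inl (h2 h)
  · right
    have := h4 (by omega)
    exact (sub_eq_zero.mp this).symm
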